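/- Let G be the subgroup of S₅ × S₅ generated by A₅ × A₅ together with the element ((1 2), (1 2)), where (1 2) denotes a transposition. Then G has 2-rank 4: G contains an elementary abelian 2-subgroup of order 16, and every elementary abelian 2-subgroup of G has order at most 16. -/

import Mathlib

/-- A subgroup `E` of a group is an elementary abelian `p`-subgroup if it is
commutative and every element `x ∈ E` satisfies `x ^ p = 1`. -/
def IsElemAbelian {G : Type*} [Group G] (p : ℕ) (E : Subgroup G) : Prop :=
  (∀ x ∈ E, ∀ y ∈ E, x * y = y * x) ∧ ∀ x ∈ E, x ^ p = 1

/-- The subgroup of `S₅ × S₅` generated by `A₅ × A₅` together with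
`((1 2), (1 2))` (realizing `(A₅ × A₅) ⋊ C₂`). -/
def exampleGroup : Subgroup (Equiv.Perm (Fin 5) × Equiv.Perm (Fin 5)) :=
  Subgroup.closure
    (((alternatingGroup (Fin 5)).prod (alternatingGroup (Fin 5)) :
        Set (Equiv.Perm (Fin 5) × Equiv.Perm (Fin 5))) ∪
      {(Equiv.swap 0 1, Equiv.swap 0 1)})

theorem IsElemAbelian.isPGroup {G : Type*} [Group G] {p : ℕ} {E : Subgroup G}
    (hE : IsElemAbelian p E) : IsPGroup p E := fun x ↦
  ⟨1, Subtype.ext (by simpa using hE.2 x x.2)⟩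

theorem IsElemAbelian.map {G H : Type*} [Group G] [Group H] {p : ℕ} {E : Subgroup G}
    (hE : IsElemAbelian p E) (f : G →* H) : IsElemAbelian p (E.map f) := by
  constructor
  · rintro _ ⟨x, hx, rfl⟩ _ ⟨y, hy, rfl⟩
    rw [← map_mul, ← map_mul, hE.1 x hx y hy]
  · rintro _ ⟨x, hx, rfl⟩
    rw [← map_pow, hE.2 x hx, map_one]

theorem IsElemAbelian.prod {G H : Type*} [Group G] [Group H] {p : ℕ} {E : Subgroup G}
    {F : Subgroup H} (hE : IsElemAbelian p E) (hF : IsElemAbelian p F) :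
    IsElemAbelian p (E.prod F) :=
  ⟨fun _ hx _ hy ↦ Prod.ext (hE.1 _ hx.1 _ hy.1) (hF.1 _ hx.2 _ hy.2),
    fun _ hx ↦ Prod.ext (hE.2 _ hx.1) (hF.2 _ hx.2)⟩

theorem IsElemAbelian.subgroupOf {G : Type*} [Group G] {p : ℕ} {E : Subgroup G}
    (hE : IsElemAbelian p E) (K : Subgroup G) : IsElemAbelian p (E.subgroupOf K) :=
  ⟨fun x hx y hy ↦ Subtype.ext (hE.1 x hx y hy), fun x hx ↦ Subtype.ext (hE.2 x hx)⟩

/-- If some Sylow `p`-subgroup has exponent dividing `n`, then every `p`-element has order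
dividing `n`. -/
theorem Sylow.pow_eq_one_of_forall_pow_eq_one {G : Type*} [Group G] [Finite G] {p n k : ℕ}
    [Fact p.Prime] (P : Sylow p G) (hP : ∀ x ∈ P, x ^ n = 1) {c : G} (hc : c ^ p ^ k = 1) :
    c ^ n = 1 := by
  have hpc : IsPGroup p (Subgroup.zpowers c) := by
    rintro ⟨_, m, rfl⟩
    refine ⟨k, Subtype.ext ?_⟩
    simp only [SubgroupClass.coe_pow, OneMemClass.coe_one]
    rw [← zpow_natCast, zpow_comm, zpow_natCast, hc, one_zpow]
  obtain ⟨Q, hQ⟩ := hpc.exists_le_sylow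
  have h : (Q.equiv P ⟨c, hQ (Subgroup.mem_zpowers c)⟩) ^ n = 1 :=
    Subtype.ext (hP _ (Q.equiv P _).2)
  rw [← map_pow, map_eq_one_iff _ (Q.equiv P).injective] at h
  exact congrArg Subtype.val h

theorem IsElemAbelian.card_perm_fin_five_le {E : Subgroup (Equiv.Perm (Fin 5))}
    (hE : IsElemAbelian 2 E) : Nat.card E ≤ 4 := by
  obtain ⟨k, hk⟩ := IsPGroup.iff_card.mp hE.isPGroup
  have hcard : Nat.card (Equiv.Perm (Fin 5)) = 2 ^ 3 * 15 := by
    rw [Nat.card_perm, Nat.card_fin]; rfl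
  have hk3 : k ≤ 3 := by
    have hdvd : 2 ^ k ∣ 2 ^ 3 * 15 := hcard ▸ hk ▸ E.card_subgroup_dvd_card
    exact (Nat.pow_dvd_pow_iff_le_right (by norm_num)).mp
      (Nat.Coprime.dvd_of_dvd_mul_right (Nat.Coprime.pow_left k (by norm_num)) hdvd)
  have hk_ne : k ≠ 3 := by
    rintro rfl
    have hfac : (2 ^ 3 * 15).factorization 2 = 3 := by
      rw [Nat.factorization_mul (by norm_num) (by norm_num), Nat.prime_two.factorization_pow,
        Finsupp.add_apply, Finsupp.single_eq_same,
        Nat.factorization_eq_zero_of_not_dvd (by norm_num)]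
    let P : Sylow 2 (Equiv.Perm (Fin 5)) := Sylow.ofCard E (by rw [hk, hcard, hfac])
    have hc : (Equiv.swap 0 1 * Equiv.swap 1 2 * Equiv.swap 2 3 : Equiv.Perm (Fin 5)) ^ 2 = 1 :=
      P.pow_eq_one_of_forall_pow_eq_one (k := 2) hE.2 (by decide)
    exact absurd hc (by decide)
  rw [hk]
  exact Nat.pow_le_pow_right (n := 2) (j := 2) (by norm_num) (by omega)

/-- The elements of the Klein four-group acting regularly on the first four letters. -/
def kleinFourFinset : Finset (Equiv.Perm (Fin 5)) :=
  {1, Equiv.swap 0 1 * Equiv.swap 2 3, Equiv.swap 0 2 * Equiv.swap 1 3,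
    Equiv.swap 0 3 * Equiv.swap 1 2}

set_option maxRecDepth 10000 in
/-- The Klein four-group acting regularly on the first four letters. -/
def kleinFourSubgroup : Subgroup (Equiv.Perm (Fin 5)) where
  carrier := kleinFourFinset
  one_mem' := by simp [kleinFourFinset]
  mul_mem' {a b} ha hb :=
    (by decide : ∀ x ∈ kleinFourFinset, ∀ y ∈ kleinFourFinset, x * y ∈ kleinFourFinset) a ha b hb
  inv_mem' {a} ha := (by decide : ∀ x ∈ kleinFourFinset, x⁻¹ ∈ kleinFourFinset) a ha

set_option maxRecDepth 10000 in
theorem isElemAbelian_kleinFourSubgroup : IsElemAbelian 2 kleinFourSubgroup :=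
  ⟨(by decide : ∀ x ∈ kleinFourFinset, ∀ y ∈ kleinFourFinset, x * y = y * x),
    (by decide : ∀ x ∈ kleinFourFinset, x ^ 2 = 1)⟩

theorem card_kleinFourSubgroup : Nat.card kleinFourSubgroup = 4 :=
  (Nat.card_eq_card_toFinset (kleinFourFinset : Set (Equiv.Perm (Fin 5)))).trans
    (by rw [Finset.toFinset_coe]; decide)

set_option maxRecDepth 10000 in
theorem kleinFourSubgroup_le_alternatingGroup :
    kleinFourSubgroup ≤ alternatingGroup (Fin 5) := fun x hx ↦
  Equiv.Perm.mem_alternatingGroup.mpr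
    ((by decide : ∀ x ∈ kleinFourFinset, Equiv.Perm.sign x = 1) x hx)

theorem Subgroup.card_prod {G H : Type*} [Group G] [Group H] (K : Subgroup G) (L : Subgroup H) :
    Nat.card (K.prod L) = Nat.card K * Nat.card L := by
  rw [Nat.card_congr (K.prodEquiv L).toEquiv, Nat.card_prod]

theorem Subgroup.card_le_card_map_fst_mul_card_map_snd {G H : Type*} [Group G] [Group H]
    [Finite G] [Finite H] (K : Subgroup (G × H)) :
    Nat.card K ≤
      Nat.card (K.map (MonoidHom.fst G H)) * Nat.card (K.map (MonoidHom.snd G H)) := by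
  rw [← Subgroup.card_prod]
  exact Subgroup.card_le_of_le (Subgroup.le_prod_iff.mpr ⟨le_rfl, le_rfl⟩)

/-- The group `(A₅ × A₅) ⋊ C₂` of Example 4.9 has 2-rank 4: it contains an
elementary abelian 2-subgroup of order 16, and every elementary abelian 2-subgroup
of it has order at most 16. -/
theorem stmt_17 :
    (∃ E : Subgroup exampleGroup, IsElemAbelian 2 E ∧ Nat.card E = 16) ∧
    ∀ E : Subgroup exampleGroup, IsElemAbelian 2 E → Nat.card E ≤ 16 := by
  refine ⟨⟨(kleinFourSubgroup.prod kleinFourSubgroup).subgroupOf exampleGroup,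
    (isElemAbelian_kleinFourSubgroup.prod isElemAbelian_kleinFourSubgroup).subgroupOf _, ?_⟩,
    fun E hE ↦ ?_⟩
  · have hle : kleinFourSubgroup.prod kleinFourSubgroup ≤ exampleGroup :=
      (Subgroup.prod_mono kleinFourSubgroup_le_alternatingGroup
        kleinFourSubgroup_le_alternatingGroup).trans
        fun x hx ↦ Subgroup.subset_closure (Or.inl hx)
    rw [Nat.card_congr (Subgroup.subgroupOfEquivOfLe hle).toEquiv, Subgroup.card_prod,
      card_kleinFourSubgroup]
  · have hF := hE.map exampleGroup.subtype
    rw [← Subgroup.card_map_of_injective exampleGroup.subtype_injective]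
    exact (Subgroup.card_le_card_map_fst_mul_card_map_snd _).trans
      (Nat.mul_le_mul (hF.map _).card_perm_fin_five_le (hF.map _).card_perm_fin_five_le)
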